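/- The single-user problem with decoding costs is equivalent to a problem with a virtual relay: the optimization problem of maximizing ∑_{i=1}^N r̄_i over pairs (r, r̄) ∈ [0,∞)^N × [0,∞)^N satisfying, for all k = 1,…,N, ∑_{i=1}^k f(r_i) ≤ ∑_{i=1}^k E_i, ∑_{i=1}^k φ(r̄_i) ≤ ∑_{i=1}^k Ē_i, and r̄_i ≤ r_i for all i, has the same optimal value as the single-user problem of maximizing ∑_{i=1}^N r_i over feasible rate policies r. -/

import Mathlib

open Finset

/-- A rate policy `r` is feasible for the single-user energy harvesting channel with
transmitter energies `E`, receiver energies `Ebar`, rate-to-power function `f`,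
and decoding cost function `φ`, over slots `1,…,N`. -/
def SUFeasible (N : ℕ) (E Ebar : ℕ → ℝ) (f φ : ℝ → ℝ) (r : ℕ → ℝ) : Prop :=
  (∀ i ∈ Finset.Icc 1 N, 0 ≤ r i) ∧
  (∀ k ∈ Finset.Icc 1 N,
      ∑ i ∈ Finset.Icc 1 k, f (r i) ≤ ∑ i ∈ Finset.Icc 1 k, E i) ∧
  (∀ k ∈ Finset.Icc 1 N,
      ∑ i ∈ Finset.Icc 1 k, φ (r i) ≤ ∑ i ∈ Finset.Icc 1 k, Ebar i)

/-- the single-user problem with decoding costs has the same optimal value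
as the problem with a virtual relay, where the transmitter rate `r` and the delivered
rate `r̄ ≤ r` are decoupled. -/
theorem virtual_relay_same_value
    (N : ℕ) (hN : 1 ≤ N)
    (E Ebar : ℕ → ℝ)
    (hE : ∀ i ∈ Finset.Icc 1 N, 0 ≤ E i)
    (hEbar : ∀ i ∈ Finset.Icc 1 N, 0 ≤ Ebar i)
    (f φ : ℝ → ℝ)
    (hf_cont : ContinuousOn f (Set.Ici 0))
    (hf_mono : StrictMonoOn f (Set.Ici 0))
    (hf_conv : StrictConvexOn ℝ (Set.Ici 0) f)
    (hf_nonneg : ∀ x : ℝ, 0 ≤ x → 0 ≤ f x)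
    (hf0 : f 0 = 0)
    (hphi_cont : ContinuousOn φ (Set.Ici 0))
    (hphi_mono : StrictMonoOn φ (Set.Ici 0))
    (hphi_conv : StrictConvexOn ℝ (Set.Ici 0) φ)
    (hphi_nonneg : ∀ x : ℝ, 0 ≤ x → 0 ≤ φ x)
    (hphi0 : φ 0 = 0) :
    sSup {S : ℝ | ∃ r rbar : ℕ → ℝ,
        (∀ i ∈ Finset.Icc 1 N, 0 ≤ r i) ∧
        (∀ i ∈ Finset.Icc 1 N, 0 ≤ rbar i) ∧
        (∀ k ∈ Finset.Icc 1 N,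
            ∑ i ∈ Finset.Icc 1 k, f (r i) ≤ ∑ i ∈ Finset.Icc 1 k, E i) ∧
        (∀ k ∈ Finset.Icc 1 N,
            ∑ i ∈ Finset.Icc 1 k, φ (rbar i) ≤ ∑ i ∈ Finset.Icc 1 k, Ebar i) ∧
        (∀ i ∈ Finset.Icc 1 N, rbar i ≤ r i) ∧
        S = ∑ i ∈ Finset.Icc 1 N, rbar i} =
    sSup {S : ℝ | ∃ r : ℕ → ℝ, SUFeasible N E Ebar f φ r ∧
        S = ∑ i ∈ Finset.Icc 1 N, r i} := by
  congr 1
  ext S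
  constructor
  · rintro ⟨r, rbar, hr, hrb, h1, h2, h3, rfl⟩
    refine ⟨rbar, ⟨hrb, ?_, h2⟩, rfl⟩
    intro k hk
    refine le_trans (Finset.sum_le_sum ?_) (h1 k hk)
    intro i hi
    have hi' : i ∈ Finset.Icc 1 N := by
      rw [Finset.mem_Icc] at *
      omega
    exact hf_mono.monotoneOn (hrb i hi') (hr i hi') (h3 i hi')
  · rintro ⟨r, ⟨hr, h1, h2⟩, rfl⟩
    exact ⟨r, r, hr, hr, h1, h2, fun _ _ => le_rfl, rfl⟩
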